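/- arXiv:1510.03833 — 3 statements merged into one kernel-verified Lean document; each statement's English description precedes it below -/
import Mathlib

section
/- Let X be a countably infinite set with two injections ι₁, ι₂ : X → ℕ, each with decidable (computable) range, which are equivalent in the sense that the bijection between the ranges sending ι₂(x) to ι₁(x) is computable with computable inverse. Let (F_n)_{n≥1} be a sequence of finite subsets of X that is canonically computable with respect to ι₁ and satisfies |F_n|/log n → ∞ as n → ∞. Let Λ be a finite alphabet and ω : X → Λ. Then limsup_{n→∞} K_{A*}((ω∘ι₁⁻¹) ∘ ι_{ι₁(F_n)}⁻¹)/|F_n| = limsup_{n→∞} K_{A*}((ω∘ι₂⁻¹) ∘ ι_{ι₂(F_n)}⁻¹)/|F_n|; i.e., the asymptotic Kolmogorov complexity of ω along (F_n) is the same for the two indexings. -/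
open Filter Topology

/-- Kolmogorov complexity of the finite word `w` w.r.t. the decompressor `A`:
the least length of a binary program `p` with `A p = w` (junk value `0` via `sInf ∅`
if no program produces `w`; for an optimal decompressor every word is produced). -/
noncomputable def KC {Λ : Type*} (A : List Bool →. List Λ) (w : List Λ) : ℕ :=
  sInf {l : ℕ | ∃ p : List Bool, p.length = l ∧ w ∈ A p}

/-- `A` is an optimal decompressor: it is partial computable and for every partial
computable decompressor `B` there is a constant `c` such that
`K_A(w) ≤ K_B(w) + c` for all words `w` (stated program-wise, which avoids any
convention for words that `B` does not produce). -/
def IsOptimalDecompressor {Λ : Type*} [Primcodable Λ] (A : List Bool →. List Λ) : Prop :=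
  Partrec A ∧
    ∀ B : List Bool →. List Λ, Partrec B → ∃ c : ℕ,
      ∀ (w : List Λ) (p : List Bool), w ∈ B p →
        ∃ q : List Bool, w ∈ A q ∧ q.length ≤ p.length + c

/-- The `Λ`-string obtained by reading the values of `ω` on the finite set `F` in the
increasing order of the indexing `ι`: the composition `(ω ∘ ι⁻¹) ∘ ι_{ι(F)}⁻¹`. -/
noncomputable def wordString {X : Type*} [Nonempty X] {Λ : Type*}
    (ι : X → ℕ) (F : Finset X) (ω : X → Λ) : List Λ :=
  ((F.image ι).sort (· ≤ ·)).map fun m => ω (Function.invFun ι m)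

/-- A sequence of finite subsets of `X` is canonically computable w.r.t. the indexing `ι`
if the map sending `n` to the canonical index `∑_{x ∈ ι(F n)} 2^x` is computable. -/
def CanonicallyComputable {X : Type*} (ι : X → ℕ) (F : ℕ → Finset X) : Prop :=
  Computable fun n => ∑ x ∈ (F n).image ι, 2 ^ x

/-! ### Computability of list operations -/

theorem Computable.list_map_right {α β σ : Type*} [Primcodable α] [Primcodable β] [Primcodable σ]
    {l : α → List β} {f : β → σ} (hl : Computable l) (hf : Computable f) :
    Computable fun a => (l a).map f := by
  have hstep : Computable₂ fun (a : α) (p : ℕ × List σ) =>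
      p.2 ++ ((l a)[p.1]?.map f).toList :=
    Computable.list_append.comp (Computable.snd.comp Computable.snd)
      (Primrec.optionToList.to_comp.comp
        (Computable.option_map
          (Computable.list_getElem?.comp (hl.comp Computable.fst)
            (Computable.fst.comp Computable.snd))
          (hf.comp Computable.snd).to₂))
  refine (Computable.nat_rec (Computable.list_length.comp hl) (Computable.const [])
    hstep).of_eq fun a => ?_
  have key : ∀ k, Nat.rec (motive := fun _ => List σ) []
      (fun i acc => acc ++ ((l a)[i]?.map f).toList) k = ((l a).take k).map f := by
    intro k
    induction k with
    | zero => simp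
    | succ k ih =>
      rw [List.take_add_one, List.map_append, ← ih, ← Option.toList_map]
  simpa using key (l a).length

theorem primrec_nat_pow : Primrec₂ ((· ^ ·) : ℕ → ℕ → ℕ) :=
  Primrec₂.unpaired'.1 Nat.Primrec.pow

theorem primrec_bitIndices : Primrec Nat.bitIndices := by
  have hbit : PrimrecRel fun i n : ℕ => n / 2 ^ i % 2 = 1 :=
    Primrec.eq.comp
      (Primrec.nat_mod.comp
        (Primrec.nat_div.comp Primrec.snd
          (primrec_nat_pow.comp (Primrec.const 2) Primrec.fst))
        (Primrec.const 2))
      (Primrec.const 1)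
  refine (hbit.listFilter.comp Primrec.list_range Primrec.id).of_eq fun n => ?_
  refine List.Perm.eq_of_sortedLE ?_ Nat.bitIndices_sorted.sortedLE ?_
  · exact ((List.pairwise_le_range).filter _).sortedLE
  · refine (List.perm_ext_iff_of_nodup (List.nodup_range.filter _) Nat.bitIndices_nodup).2 ?_
    intro i
    have hlt : n.testBit i = true → i < n := fun h =>
      (Nat.lt_two_pow_self).trans_le (Nat.ge_two_pow_of_testBit h)
    simp only [List.mem_filter, List.mem_range, Nat.mem_bitIndices, id]
    rw [Nat.testBit_eq_decide_div_mod_eq] at *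
    exact ⟨fun h => h.2, fun h => ⟨hlt h, h⟩⟩

/-- The entries of `w`, listed in the increasing order of the labels given by `J`. -/
def sortAlong {α : Type*} (J : List ℕ) (w : List α) : List α :=
  (List.range (J.foldr max 0 + 1)).flatMap fun m => (w[J.idxOf m]?).toList

theorem primrec_sortAlong {α : Type*} [Primcodable α] :
    Primrec₂ (sortAlong : List ℕ → List α → List α) := by
  have hmax : Primrec fun J : List ℕ => J.foldr max 0 + 1 :=
    Primrec.succ.comp (Primrec.list_foldr Primrec.id (Primrec.const 0)
      (Primrec.nat_max.comp (Primrec.fst.comp Primrec.snd) (Primrec.snd.comp Primrec.snd)).to₂)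
  exact Primrec.list_flatMap (Primrec.list_range.comp (hmax.comp Primrec.fst))
    (Primrec.optionToList.comp (Primrec.list_getElem?.comp (Primrec.snd.comp Primrec.fst)
      (Primrec.list_idxOf.comp Primrec.snd (Primrec.fst.comp Primrec.fst)))).to₂

theorem List.le_foldr_max {J : List ℕ} {m : ℕ} (h : m ∈ J) : m ≤ J.foldr max 0 := by
  induction J with
  | nil => simp at h
  | cons a J ih =>
    rcases List.mem_cons.1 h with rfl | h
    · simp
    · exact (ih h).trans (by simp)

theorem sortAlong_map {α : Type*} (J : List ℕ) (f : ℕ → α) :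
    sortAlong J (J.map f) = (J.toFinset.sort (· ≤ ·)).map f := by
  have hsort : J.toFinset.sort (· ≤ ·) =
      (List.range (J.foldr max 0 + 1)).filter (· ∈ J) := by
    refine List.Perm.eq_of_sortedLE (Finset.sortedLT_sort _).sortedLE
      ((List.pairwise_le_range).filter _).sortedLE ?_
    refine (List.perm_ext_iff_of_nodup (Finset.sort_nodup _ _) (List.nodup_range.filter _)).2 ?_
    intro m
    simp only [Finset.mem_sort, List.mem_toFinset, List.mem_filter, List.mem_range,
      decide_eq_true_eq]
    exact ⟨fun h => ⟨Nat.lt_succ_of_le (List.le_foldr_max h), h⟩, fun h => h.2⟩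
  have hentry : ∀ m, ((J.map f)[J.idxOf m]?).toList = if m ∈ J then [f m] else [] := by
    intro m
    split_ifs with h
    · simp [List.getElem?_idxOf h]
    · simp [List.idxOf_eq_length h]
  rw [hsort, sortAlong]
  simp only [hentry]
  generalize List.range (J.foldr max 0 + 1) = R
  induction R with
  | nil => rfl
  | cons a R ih => by_cases h : a ∈ J <;> simp [h, ih]

theorem sortAlong_self (J : List ℕ) : sortAlong J J = J.toFinset.sort (· ≤ ·) := by
  simpa using sortAlong_map J id

/-! ### A self-delimiting code for natural numbers -/

/-- A self-delimiting binary code of length `2 * n.size + 1`. -/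
def selfDelimiting (n : ℕ) : List Bool :=
  List.replicate n.size true ++ false :: n.bits

/-- The number with the given binary digits, least significant first. -/
def natOfBits (l : List Bool) : ℕ :=
  l.foldr (fun b n => 2 * n + cond b 1 0) 0

theorem natOfBits_bits (n : ℕ) : natOfBits n.bits = n := by
  induction n using Nat.binaryRec' with
  | zero => simp [natOfBits]
  | bit b n h ih =>
    rw [Nat.bits_append_bit _ _ h]
    change 2 * natOfBits n.bits + cond b 1 0 = _
    rw [ih, Nat.bit_val]
    cases b <;> rfl

theorem primrec_natOfBits : Primrec natOfBits :=
  Primrec.list_foldr Primrec.id (Primrec.const 0)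
    (Primrec.nat_add.comp
      (Primrec.nat_mul.comp (Primrec.const 2) (Primrec.snd.comp Primrec.snd))
      (Primrec.cond (Primrec.fst.comp Primrec.snd) (Primrec.const 1) (Primrec.const 0))).to₂

/-- Split a program into a number given by its self-delimiting code and the remaining word. -/
def splitProgram (p : List Bool) : ℕ × List Bool :=
  (natOfBits ((p.drop (p.findIdx (!·) + 1)).take (p.findIdx (!·))),
    (p.drop (p.findIdx (!·) + 1)).drop (p.findIdx (!·)))

theorem primrec_splitProgram : Primrec splitProgram := by
  have hidx : Primrec fun p : List Bool => p.findIdx (!·) :=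
    Primrec.list_findIdx Primrec.id (Primrec.not.comp Primrec.snd).to₂
  have hrest : Primrec fun p : List Bool => p.drop (p.findIdx (!·) + 1) :=
    Primrec.list_drop.comp (Primrec.succ.comp hidx) Primrec.id
  exact Primrec.pair (primrec_natOfBits.comp (Primrec.list_take.comp hidx hrest))
    (Primrec.list_drop.comp hidx hrest)

theorem splitProgram_selfDelimiting_append (n : ℕ) (q : List Bool) :
    splitProgram (selfDelimiting n ++ q) = (n, q) := by
  have hidx : (selfDelimiting n ++ q).findIdx (!·) = n.size := by
    have htrue : (List.replicate n.size true).findIdx (!·) = n.size := by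
      simpa using List.findIdx_eq_length_of_false
        (xs := List.replicate n.size true) (p := (!·)) (by simp)
    simp [selfDelimiting, List.findIdx_append, List.findIdx_cons, htrue]
  have hrest : (selfDelimiting n ++ q).drop (n.size + 1) = n.bits ++ q := by
    simp [selfDelimiting, List.drop_append]
  rw [splitProgram, hidx, hrest, ← Nat.size_eq_bits_len]
  simp [natOfBits_bits]

theorem length_selfDelimiting (n : ℕ) : (selfDelimiting n).length = 2 * n.size + 1 := by
  simp [selfDelimiting, Nat.size_eq_bits_len]
  ring

/-! ### Complexity of computable images -/

section Complexity

variable {Λ : Type*} {A : List Bool →. List Λ}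

theorem KC_le_length {w : List Λ} {p : List Bool} (h : w ∈ A p) : KC A w ≤ p.length :=
  Nat.sInf_le ⟨p, rfl, h⟩

variable [Primcodable Λ]

theorem IsOptimalDecompressor.exists_program (hA : IsOptimalDecompressor A) (w : List Λ) :
    ∃ p, w ∈ A p ∧ p.length = KC A w := by
  obtain ⟨c, hc⟩ := hA.2 (fun _ => Part.some w) (Computable.const w)
  obtain ⟨q, hq, -⟩ := hc w [] (Part.mem_some w)
  obtain ⟨p, hp, hw⟩ := Nat.sInf_mem
    (s := {l : ℕ | ∃ p : List Bool, p.length = l ∧ w ∈ A p}) ⟨_, q, rfl, hq⟩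
  exact ⟨p, hw, hp⟩

theorem IsOptimalDecompressor.exists_KC_le (hA : IsOptimalDecompressor A)
    {g : ℕ → List Λ → List Λ} (hg : Computable₂ g) :
    ∃ c : ℕ, ∀ n w, KC A (g n w) ≤ KC A w + 2 * n.size + c := by
  have hB : Partrec fun p : List Bool =>
      (A (splitProgram p).2).map (g (splitProgram p).1) :=
    (hA.1.comp (Computable.snd.comp primrec_splitProgram.to_comp)).map
      (hg.comp (Computable.fst.comp (primrec_splitProgram.to_comp.comp Computable.fst))
        Computable.snd).to₂
  obtain ⟨c, hc⟩ := hA.2 _ hB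
  refine ⟨c + 1, fun n w => ?_⟩
  obtain ⟨p, hp, hlen⟩ := hA.exists_program w
  obtain ⟨q, hq, hql⟩ := hc (g n w) (selfDelimiting n ++ p) (by
    rw [splitProgram_selfDelimiting_append]
    exact Part.mem_map _ hp)
  have := KC_le_length hq
  rw [List.length_append, length_selfDelimiting] at hql
  omega

end Complexity

/-! ### Change of indexing -/

section Reindex

variable {X : Type*} {ι₁ ι₂ : X → ℕ} {v : ℕ → ℕ} {F : ℕ → Finset X}

theorem CanonicallyComputable.computable_sort (h : CanonicallyComputable ι₁ F) :
    Computable fun n => ((F n).image ι₁).sort (· ≤ ·) := by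
  refine (primrec_bitIndices.to_comp.comp h).of_eq fun n => ?_
  rw [← Nat.bitIndices_sum_map_two_pow (Finset.sortedLT_sort ((F n).image ι₁))]
  congr 1
  rw [← List.sum_toFinset _ (Finset.sort_nodup _ _), Finset.sort_toFinset]

theorem toFinset_map_sort_image (hv : ∀ x, v (ι₁ x) = ι₂ x) (s : Finset X) :
    (((s.image ι₁).sort (· ≤ ·)).map v).toFinset = s.image ι₂ := by
  ext m
  simp [hv]

theorem computable_sort_image_of_reindex (hvc : Computable v) (hv : ∀ x, v (ι₁ x) = ι₂ x)
    (h : Computable fun n => ((F n).image ι₁).sort (· ≤ ·)) :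
    Computable fun n => ((F n).image ι₂).sort (· ≤ ·) := by
  refine (primrec_sortAlong.to_comp.comp (h.list_map_right hvc) (h.list_map_right hvc)).of_eq
    fun n => ?_
  rw [sortAlong_self, toFinset_map_sort_image hv]

theorem sortAlong_wordString [Nonempty X] {Λ : Type*} (h₁ : Function.Injective ι₁)
    (h₂ : Function.Injective ι₂) (hv : ∀ x, v (ι₁ x) = ι₂ x) (s : Finset X) (ω : X → Λ) :
    sortAlong (((s.image ι₁).sort (· ≤ ·)).map v) (wordString ι₁ s ω) = wordString ι₂ s ω := by
  have hword : wordString ι₁ s ω =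
      (((s.image ι₁).sort (· ≤ ·)).map v).map fun m => ω (Function.invFun ι₂ m) := by
    rw [wordString, List.map_map]
    refine List.map_congr_left fun m hm => ?_
    obtain ⟨x, -, rfl⟩ := Finset.mem_image.1 ((Finset.mem_sort _).1 hm)
    simp [hv, Function.leftInverse_invFun h₁ x, Function.leftInverse_invFun h₂ x]
  rw [hword, sortAlong_map, toFinset_map_sort_image hv]
  rfl

theorem IsOptimalDecompressor.exists_KC_wordString_le [Nonempty X] {Λ : Type*} [Primcodable Λ]
    {A : List Bool →. List Λ} (hA : IsOptimalDecompressor A)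
    (h₁ : Function.Injective ι₁) (h₂ : Function.Injective ι₂)
    (hvc : Computable v) (hv : ∀ x, v (ι₁ x) = ι₂ x)
    (h : Computable fun n => ((F n).image ι₁).sort (· ≤ ·)) (ω : X → Λ) :
    ∃ c : ℕ, ∀ n,
      KC A (wordString ι₂ (F n) ω) ≤ KC A (wordString ι₁ (F n) ω) + 2 * n.size + c := by
  obtain ⟨c, hc⟩ := hA.exists_KC_le (g := fun n w =>
    sortAlong (((F n).image ι₁ |>.sort (· ≤ ·)).map v) w)
    (primrec_sortAlong.to_comp.comp ((h.list_map_right hvc).comp Computable.fst)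
      Computable.snd).to₂
  refine ⟨c, fun n => ?_⟩
  simpa only [sortAlong_wordString h₁ h₂ hv] using hc n (wordString ι₁ (F n) ω)

end Reindex

/-! ### Asymptotics -/

theorem Nat.size_le_two_mul_log_add_one {n : ℕ} (hn : n ≠ 0) :
    (n.size : ℝ) ≤ 2 * Real.log n + 1 := by
  obtain ⟨k, hk⟩ : ∃ k, n.size = k + 1 :=
    Nat.exists_eq_succ_of_ne_zero (Nat.size_pos.2 (Nat.pos_of_ne_zero hn)).ne'
  have hpow : 2 ^ k ≤ n := Nat.lt_size.1 (by omega)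
  have hlog : (k : ℝ) * Real.log 2 ≤ Real.log n := by
    rw [← Real.log_pow]
    exact Real.log_le_log (by positivity) (by exact_mod_cast hpow)
  have hk0 : (0 : ℝ) ≤ k := k.cast_nonneg
  rw [hk]
  push_cast
  nlinarith [Real.log_two_gt_d9]

theorem eventually_div_le_div_add {K₁ K₂ d : ℕ → ℕ}
    (hd : Tendsto (fun n => (d n : ℝ) / Real.log n) atTop atTop)
    {c : ℕ} (hK : ∀ n, K₂ n ≤ K₁ n + 2 * n.size + c) {ε : ℝ} (hε : 0 < ε) :
    ∀ᶠ n in atTop, (K₂ n : ℝ) / d n ≤ (K₁ n : ℝ) / d n + ε := by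
  filter_upwards [hd.eventually_ge_atTop ((6 + c) / ε), eventually_ge_atTop 3] with n hn hn3
  have hlog : 1 ≤ Real.log n := by
    rw [Real.le_log_iff_exp_le (by positivity)]
    have : (3 : ℝ) ≤ n := by exact_mod_cast hn3
    linarith [Real.exp_one_lt_d9]
  have hlow : (6 + c) * Real.log n ≤ ε * d n := by
    rw [le_div_iff₀ (by linarith), div_mul_eq_mul_div, div_le_iff₀ hε] at hn
    linarith
  have hc0 : (0 : ℝ) ≤ c := c.cast_nonneg
  have hd0 : (0 : ℝ) < d n := by
    by_contra! h
    nlinarith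
  have hsize := Nat.size_le_two_mul_log_add_one (n := n) (by omega)
  have hKn : (K₂ n : ℝ) ≤ K₁ n + 2 * n.size + c := by exact_mod_cast hK n
  rw [div_add' _ _ _ hd0.ne', div_le_div_iff_of_pos_right hd0]
  nlinarith

theorem Real.limsup_eq_of_forall_eventually_le_add {a b : ℕ → ℝ} (ha : ∀ n, 0 ≤ a n)
    (hb : ∀ n, 0 ≤ b n) (hab : ∀ ε > 0, ∀ᶠ n in atTop, a n ≤ b n + ε)
    (hba : ∀ ε > 0, ∀ᶠ n in atTop, b n ≤ a n + ε) :
    limsup a atTop = limsup b atTop := by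
  have hbdd : ∀ {a : ℕ → ℝ}, (∀ n, 0 ≤ a n) → BddBelow {x | ∀ᶠ n in atTop, a n ≤ x} :=
    fun ha => ⟨0, fun x hx => by
      obtain ⟨n, hn⟩ := hx.exists
      exact (ha n).trans hn⟩
  have hmem : ∀ {a b : ℕ → ℝ}, (∀ ε > 0, ∀ᶠ n in atTop, a n ≤ b n + ε) → ∀ ε > 0, ∀ x,
      (∀ᶠ n in atTop, b n ≤ x) → ∀ᶠ n in atTop, a n ≤ x + ε := by
    intro a b hab ε hε x hx
    filter_upwards [hab ε hε, hx] with n h₁ h₂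
    linarith
  have hle : ∀ {a b : ℕ → ℝ}, (∀ n, 0 ≤ a n) → (∀ ε > 0, ∀ᶠ n in atTop, a n ≤ b n + ε) →
      {x | ∀ᶠ n in atTop, b n ≤ x}.Nonempty → limsup a atTop ≤ limsup b atTop := by
    intro a b ha hab hne
    rw [limsup_eq, limsup_eq]
    refine le_of_forall_pos_le_add fun ε hε => ?_
    rw [← sub_le_iff_le_add]
    refine le_csInf hne fun x hx => ?_
    rw [sub_le_iff_le_add]
    exact csInf_le (hbdd ha) (hmem hab ε hε x hx)
  by_cases hne : {x | ∀ᶠ n in atTop, b n ≤ x}.Nonempty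
  · obtain ⟨x, hx⟩ := hne
    exact le_antisymm (hle ha hab ⟨x, hx⟩)
      (hle hb hba ⟨x + 1, hmem hab 1 one_pos x hx⟩)
  · have hne' : ¬ {x | ∀ᶠ n in atTop, a n ≤ x}.Nonempty := fun ⟨x, hx⟩ =>
      hne ⟨x + 1, hmem hba 1 one_pos x hx⟩
    rw [limsup_eq, limsup_eq, Set.not_nonempty_iff_eq_empty.1 hne,
      Set.not_nonempty_iff_eq_empty.1 hne']

theorem stmt6 {X : Type*} [Countable X] [Infinite X]
    {Λ : Type*} [Fintype Λ] [Primcodable Λ]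
    (ι₁ ι₂ : X → ℕ) (h₁ : Function.Injective ι₁) (h₂ : Function.Injective ι₂)
    (hr₁ : ∃ χ : ℕ → Bool, Computable χ ∧ ∀ m, χ m = true ↔ m ∈ Set.range ι₁)
    (hr₂ : ∃ χ : ℕ → Bool, Computable χ ∧ ∀ m, χ m = true ↔ m ∈ Set.range ι₂)
    (hequiv : ∃ u v : ℕ → ℕ, Computable u ∧ Computable v ∧
      (∀ x, u (ι₂ x) = ι₁ x) ∧ (∀ x, v (ι₁ x) = ι₂ x))
    (F : ℕ → Finset X)
    (hcc : CanonicallyComputable ι₁ F)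
    (hgrowth : Tendsto (fun n => ((F n).card : ℝ) / Real.log n) atTop atTop)
    (A : List Bool →. List Λ) (hA : IsOptimalDecompressor A)
    (ω : X → Λ) :
    limsup (fun n => (KC A (wordString ι₁ (F n) ω) : ℝ) / (F n).card) atTop =
      limsup (fun n => (KC A (wordString ι₂ (F n) ω) : ℝ) / (F n).card) atTop := by
  obtain ⟨u, v, huc, hvc, hu, hv⟩ := hequiv
  have hs₁ := hcc.computable_sort
  have hs₂ := computable_sort_image_of_reindex hvc hv hs₁
  obtain ⟨c, hc⟩ := hA.exists_KC_wordString_le h₁ h₂ hvc hv hs₁ ω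
  obtain ⟨c', hc'⟩ := hA.exists_KC_wordString_le h₂ h₁ huc hu hs₂ ω
  exact Real.limsup_eq_of_forall_eventually_le_add (fun n => by positivity)
    (fun n => by positivity)
    (fun ε hε => eventually_div_le_div_add hgrowth hc' hε)
    (fun ε hε => eventually_div_le_div_add hgrowth hc hε)
end

section
/- Let Γ be a countably infinite group and ([F_n, Z_n])_{n≥1} a symmetric left Følner monotiling of Γ with e ∈ F_n for every n, such that (F_n) is a tempered two-sided Følner sequence. Let (X, μ, Γ) be an ergodic measure-preserving system such that for every k ≥ 1 the indicator 1_{Z_k} is a good weight for X along (F_n). For each k ≥ 1 let β_k = {B^k_1, …, B^k_{M_k}} be a finite measurable partition of X, and for h ∈ Γ let π^{k,h}_m(ω) := lim_{n→∞} (1/|F_n ∩ Z_k|) ∑_{g∈F_n∩Z_k} 1_{B^k_m}((gh)·ω) (which exists for μ-a.e. ω). Then for μ-a.e. ω ∈ X and every k ≥ 1 there exists h = h_k(ω) ∈ F_k⁻¹ such that −∑_{m=1}^{M_k} π^{k,h}_m(ω) log₂ π^{k,h}_m(ω) ≤ H_μ(β_k). -/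
open scoped Pointwise
open Filter Topology MeasureTheory

/-- `(F n)` is a left Følner sequence. -/
def IsLeftFolner {Γ : Type*} [Group Γ] [DecidableEq Γ] (F : ℕ → Finset Γ) : Prop :=
  (∀ n, (F n).Nonempty) ∧
    ∀ K : Finset Γ,
      Tendsto (fun n => ((symmDiff (F n) (K * F n)).card : ℝ) / (F n).card) atTop (𝓝 0)

/-- `(F n)` is a right Følner sequence. -/
def IsRightFolner {Γ : Type*} [Group Γ] [DecidableEq Γ] (F : ℕ → Finset Γ) : Prop :=
  (∀ n, (F n).Nonempty) ∧
    ∀ K : Finset Γ,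
      Tendsto (fun n => ((symmDiff (F n) (F n * K)).card : ℝ) / (F n).card) atTop (𝓝 0)

/-- `(F n)` is tempered. -/
def IsTempered {Γ : Type*} [Group Γ] [DecidableEq Γ] (F : ℕ → Finset Γ) : Prop :=
  ∃ C : ℝ, ∀ j, (((Finset.range j).biUnion fun i => (F i)⁻¹ * F j).card : ℝ) ≤ C * (F j).card

/-- `[F, Z]` is a left monotiling of `Γ`. -/
def IsLeftMonotiling {Γ : Type*} [Group Γ] (F Z : Set Γ) : Prop :=
  ∀ g : Γ, ∃! p : Γ × Γ, p.1 ∈ F ∧ p.2 ∈ Z ∧ g = p.1 * p.2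

/-- `c` is a good weight for the `Γ`-action on `(X, μ)` along `(F n)`. -/
def IsGoodWeight {Γ : Type*} [Group Γ] (c : Γ → ℝ) (F : ℕ → Finset Γ)
    {X : Type*} [MeasurableSpace X] [MulAction Γ X] (μ : Measure X) : Prop :=
  ∀ f : X → ℝ, Measurable f → (∃ M, ∀ x, |f x| ≤ M) →
    ∀ᵐ ω ∂μ, ∃ L : ℝ,
      Tendsto (fun n => ((F n).card : ℝ)⁻¹ * ∑ g ∈ F n, c g * f (g • ω)) atTop (𝓝 L)

lemma abs_sum_sub_sum_le_card_symmDiff {ι : Type*} [DecidableEq ι] (s t : Finset ι)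
    (ψ : ι → ℝ) (hψ : ∀ i, |ψ i| ≤ 1) :
    |∑ i ∈ t, ψ i - ∑ i ∈ s, ψ i| ≤ (symmDiff s t).card := by
  have h1 : ∑ i ∈ t, ψ i - ∑ i ∈ s, ψ i = ∑ i ∈ t \ s, ψ i - ∑ i ∈ s \ t, ψ i :=
    (Finset.sum_sdiff_sub_sum_sdiff).symm
  have hb : ∀ u : Finset ι, |∑ i ∈ u, ψ i| ≤ u.card := fun u =>
    (Finset.abs_sum_le_sum_abs _ _).trans
      ((Finset.sum_le_sum fun i _ => hψ i).trans (by simp))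
  have hc : (symmDiff s t).card = (s \ t).card + (t \ s).card :=
    Finset.card_union_of_disjoint disjoint_sdiff_sdiff
  rw [h1, hc]
  push_cast
  linarith [abs_sub (∑ i ∈ t \ s, ψ i) (∑ i ∈ s \ t, ψ i), hb (t \ s), hb (s \ t)]

/-- For a symmetric set of centers, the translates of `Z` by the inverses of the tile partition
the group. -/
lemma IsLeftMonotiling.sum_indicator_mul_eq_one {Γ : Type*} [Group Γ] {T : Finset Γ} {Z : Set Γ}
    (hT : IsLeftMonotiling (↑T) Z) (hZ : Z⁻¹ = Z) (g : Γ) :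
    ∑ f ∈ T, Set.indicator Z (1 : Γ → ℝ) (g * f) = 1 := by
  obtain ⟨⟨f₀, z₀⟩, ⟨hf, hz, hg⟩, huniq⟩ := hT g⁻¹
  have hgf : ∀ f, (g * f)⁻¹ ∈ Z ↔ g * f ∈ Z := fun f => by
    rw [← Set.mem_inv, hZ]
  rw [Finset.sum_eq_single f₀]
  · have : g * f₀ ∈ Z := by
      rw [← hgf, mul_inv_rev, hg]
      simpa using hz
    simp [this]
  · intro f hfT hne
    refine Set.indicator_of_notMem (fun hmem => hne ?_) _
    have := huniq (f, (g * f)⁻¹) ⟨hfT, (hgf f).2 hmem, by simp⟩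
    exact congrArg Prod.fst this
  · exact fun h => absurd hf h

section Folner

variable {Γ : Type*} [Group Γ] [DecidableEq Γ] {F : ℕ → Finset Γ}

/-- Averages of a bounded function along a right Følner sequence are asymptotically invariant
under right translation. -/
lemma IsRightFolner.tendsto_average_translate_sub (hF : IsRightFolner F) (γ : Γ) (ψ : Γ → ℝ)
    (hψ : ∀ g, |ψ g| ≤ 1) :
    Tendsto (fun n => ((F n).card : ℝ)⁻¹ * (∑ g ∈ F n, ψ (g * γ) - ∑ g ∈ F n, ψ g))
      atTop (𝓝 0) := by
  refine squeeze_zero_norm (fun n => ?_) (hF.2 {γ})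
  have h : ∑ g ∈ F n, ψ (g * γ) = ∑ g ∈ F n * {γ}, ψ g := by
    rw [Finset.mul_singleton]
    exact (Finset.sum_image (fun a _ b _ hab => mul_right_cancel hab)).symm
  rw [h, norm_mul, Real.norm_eq_abs, Real.norm_eq_abs, abs_of_nonneg (by positivity),
    div_eq_inv_mul]
  exact mul_le_mul_of_nonneg_left (abs_sum_sub_sum_le_card_symmDiff _ _ ψ hψ) (by positivity)

/-- Summing over the centers and then over the tile is asymptotically the same as summing
over the Følner set. -/
lemma IsRightFolner.tendsto_sum_tile_sub (hF : IsRightFolner F) {T : Finset Γ} {Z : Set Γ}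
    (hT : IsLeftMonotiling (↑T) Z) (hZ : Z⁻¹ = Z) (φ : Γ → ℝ) (hφ : ∀ g, |φ g| ≤ 1) :
    Tendsto (fun n => ((F n).card : ℝ)⁻¹ *
      (∑ f ∈ T, ∑ g ∈ F n, Set.indicator Z 1 g * φ (g * f⁻¹) - ∑ g ∈ F n, φ g))
      atTop (𝓝 0) := by
  have key : ∀ f ∈ T, Tendsto (fun n => ((F n).card : ℝ)⁻¹ *
      (∑ g ∈ F n, Set.indicator Z 1 g * φ (g * f⁻¹)
        - ∑ g ∈ F n, Set.indicator Z 1 (g * f) * φ g)) atTop (𝓝 0) := by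
    intro f _
    have := hF.tendsto_average_translate_sub f⁻¹
      (fun g => Set.indicator Z 1 (g * f) * φ g) (fun g => by
        by_cases h : g * f ∈ Z
        · simpa [h] using hφ g
        · simp [h])
    simpa using this
  have hsum := tendsto_finsetSum T key
  rw [Finset.sum_const_zero] at hsum
  refine hsum.congr fun n => ?_
  rw [← Finset.mul_sum, Finset.sum_sub_distrib]
  congr 2
  rw [Finset.sum_comm]
  refine Finset.sum_congr rfl fun g _ => ?_
  rw [← Finset.sum_mul, hT.sum_indicator_mul_eq_one hZ, one_mul]

/-- The set of centers has density `1 / |T|` along a right Følner sequence. -/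
lemma IsRightFolner.tendsto_density_centers (hF : IsRightFolner F) {T : Finset Γ} {Z : Set Γ}
    (hT : IsLeftMonotiling (↑T) Z) (hZ : Z⁻¹ = Z) (hne : T.Nonempty) :
    Tendsto (fun n => ((F n).card : ℝ)⁻¹ * (Nat.card ↥((↑(F n) : Set Γ) ∩ Z) : ℝ))
      atTop (𝓝 (T.card : ℝ)⁻¹) := by
  classical
  have hT0 : (T.card : ℝ) ≠ 0 := by exact_mod_cast hne.card_pos.ne'
  have h := hF.tendsto_sum_tile_sub hT hZ (fun _ => 1) (by simp)
  have h2 := (h.add_const 1).const_mul (T.card : ℝ)⁻¹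
  rw [zero_add, mul_one] at h2
  refine h2.congr fun n => ?_
  have hF0 : ((F n).card : ℝ) ≠ 0 := by exact_mod_cast (hF.1 n).card_pos.ne'
  have hc : ∑ g ∈ F n, Set.indicator Z (1 : Γ → ℝ) g = Nat.card ↥((↑(F n) : Set Γ) ∩ Z) := by
    have : ((↑(F n) : Set Γ) ∩ Z) = ↑((F n).filter (· ∈ Z)) := by
      ext; simp
    rw [this, Nat.card_coe_set_eq, Set.ncard_coe_finset]
    simp [Set.indicator_apply]
  simp only [mul_one, hc, Finset.sum_const, nsmul_eq_mul]
  field_simp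
  ring

/-- If the averages over the centers of all the translates by the tile converge, then the Følner
averages converge to the mean of these limits. -/
lemma IsRightFolner.tendsto_average_of_tendsto_centers (hF : IsRightFolner F) {T : Finset Γ}
    {Z : Set Γ} (hT : IsLeftMonotiling (↑T) Z) (hZ : Z⁻¹ = Z) (hne : T.Nonempty)
    (φ : Γ → ℝ) (hφ : ∀ g, |φ g| ≤ 1) (p : Γ → ℝ)
    (hp : ∀ f ∈ T, Tendsto (fun n => (Nat.card ↥((↑(F n) : Set Γ) ∩ Z) : ℝ)⁻¹ *
      ∑ g ∈ F n, Set.indicator Z 1 g * φ (g * f⁻¹)) atTop (𝓝 (p f))) :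
    Tendsto (fun n => ((F n).card : ℝ)⁻¹ * ∑ g ∈ F n, φ g) atTop
      (𝓝 ((T.card : ℝ)⁻¹ * ∑ f ∈ T, p f)) := by
  have hd := hF.tendsto_density_centers hT hZ hne
  have hpos : (0 : ℝ) < (T.card : ℝ)⁻¹ := by
    have := hne.card_pos
    positivity
  have h := (hd.mul (tendsto_finsetSum T hp)).sub (hF.tendsto_sum_tile_sub hT hZ φ hφ)
  rw [sub_zero] at h
  refine h.congr' ?_
  filter_upwards [hd.eventually_const_lt hpos] with n hn
  have hc : (Nat.card ↥((↑(F n) : Set Γ) ∩ Z) : ℝ) ≠ 0 := by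
    intro h0
    rw [h0, mul_zero] at hn
    exact hn.false
  rw [← Finset.mul_sum]
  field_simp
  ring

variable {X : Type*} [MeasurableSpace X] [MulAction Γ X]

/-- For an ergodic action, an almost everywhere limit of averages along a right Følner sequence
equals the integral almost everywhere. -/
lemma IsRightFolner.ae_eq_integral_of_tendsto (hF : IsRightFolner F) (μ : Measure X)
    [IsProbabilityMeasure μ]
    (hmp : ∀ g : Γ, MeasurePreserving (fun x : X => g • x) μ μ)
    (herg : ∀ E : Set X, MeasurableSet E → (∀ g : Γ, (fun x : X => g • x) ⁻¹' E = E) →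
      μ E = 0 ∨ μ E = 1)
    (f : X → ℝ) (hf : Measurable f) (hb : ∀ x, |f x| ≤ 1) (L : X → ℝ)
    (hL : ∀ᵐ ω ∂μ, Tendsto (fun n => ((F n).card : ℝ)⁻¹ * ∑ g ∈ F n, f (g • ω))
      atTop (𝓝 (L ω))) :
    ∀ᵐ ω ∂μ, L ω = ∫ x, f x ∂μ := by
  set A : ℕ → X → ℝ := fun n ω => ((F n).card : ℝ)⁻¹ * ∑ g ∈ F n, f (g • ω) with hA
  have hAm : ∀ n, Measurable (A n) := fun n =>
    (Finset.measurable_sum _ fun g _ => hf.comp (hmp g).measurable).const_mul _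
  have hF0 : ∀ n, ((F n).card : ℝ) ≠ 0 := fun n => by exact_mod_cast (hF.1 n).card_pos.ne'
  have hAb : ∀ n ω, ‖A n ω‖ ≤ 1 := fun n ω => by
    have h1 : |∑ g ∈ F n, f (g • ω)| ≤ (F n).card :=
      (Finset.abs_sum_le_sum_abs _ _).trans
        ((Finset.sum_le_sum fun g _ => hb (g • ω)).trans (by simp))
    rw [Real.norm_eq_abs, hA]
    simp only [abs_mul, abs_inv, Nat.abs_cast]
    rw [inv_mul_le_iff₀ (by exact_mod_cast (hF.1 n).card_pos), mul_one]
    exact h1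
  have hfi : Integrable f μ :=
    Integrable.of_bound hf.aestronglyMeasurable 1 (ae_of_all _ hb)
  have hAint : ∀ n, ∫ ω, A n ω ∂μ = ∫ x, f x ∂μ := fun n => by
    have hi : ∀ g ∈ F n, Integrable (fun ω => f (g • ω)) μ := fun g _ =>
      ((hmp g).integrable_comp hf.aestronglyMeasurable).2 hfi
    have hg : ∀ g ∈ F n, ∫ ω, f (g • ω) ∂μ = ∫ x, f x ∂μ := fun g _ => by
      have := integral_map (μ := μ) (hmp g).measurable.aemeasurable
        (f := f) hf.aestronglyMeasurable
      rw [(hmp g).map_eq] at this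
      exact this.symm
    simp only [hA]
    rw [integral_const_mul, integral_finsetSum _ hi, Finset.sum_congr rfl hg, Finset.sum_const,
      nsmul_eq_mul, inv_mul_cancel_left₀ (hF0 n)]
  have hLm : AEStronglyMeasurable L μ :=
    aestronglyMeasurable_of_tendsto_ae atTop (fun n => (hAm n).aestronglyMeasurable) hL
  have hLint : ∫ ω, L ω ∂μ = ∫ x, f x ∂μ := by
    have h := tendsto_integral_of_dominated_convergence (fun _ => (1 : ℝ))
      (fun n => (hAm n).aestronglyMeasurable) (integrable_const _)
      (fun n => ae_of_all _ (hAb n)) hL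
    simp only [hAint] at h
    exact (tendsto_nhds_unique h tendsto_const_nhds)
  have hLi : Integrable L μ := by
    refine Integrable.of_bound hLm 1 ?_
    filter_upwards [hL] with ω hω
    exact le_of_tendsto hω.norm (Eventually.of_forall fun n => hAb n ω)
  have hzo : ∀ q : ℝ, (∀ᵐ ω ∂μ, q ≤ L ω) ∨ ∀ᵐ ω ∂μ, L ω ≤ q := by
    intro q
    set E : Set X := {ω | ∀ j : ℕ, ∀ᶠ n in atTop, A n ω < q + 1 / ((j : ℝ) + 1)} with hE
    have hEm : MeasurableSet E := by
      simp only [hE, eventually_atTop, Set.ofPred_forall, Set.ofPred_exists]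
      exact MeasurableSet.iInter fun j => MeasurableSet.iUnion fun N =>
        MeasurableSet.iInter fun n => MeasurableSet.iInter fun _ =>
          measurableSet_lt (hAm n) measurable_const
    have hsub : ∀ (γ : Γ) ω, ω ∈ E → γ • ω ∈ E := by
      intro γ ω hω j
      have h0 := hF.tendsto_average_translate_sub γ (fun g => f (g • ω)) fun g => hb _
      obtain ⟨i, hi⟩ := exists_nat_one_div_lt (K := ℝ)
        (show (0 : ℝ) < 1 / ((j : ℝ) + 1) by positivity)
      filter_upwards [hω i, h0.eventually_lt_const (sub_pos.2 hi)] with n h1 h2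
      have h3 : A n (γ • ω) = A n ω + ((F n).card : ℝ)⁻¹ *
          (∑ g ∈ F n, f ((g * γ) • ω) - ∑ g ∈ F n, f (g • ω)) := by
        simp only [hA, mul_smul]
        ring
      rw [h3]
      linarith
    have hinv : ∀ g : Γ, (fun x : X => g • x) ⁻¹' E = E := fun g => by
      ext ω
      refine ⟨fun h => ?_, hsub g ω⟩
      simpa using hsub g⁻¹ _ h
    rcases herg E hEm hinv with h0 | h1
    · left
      filter_upwards [hL, measure_eq_zero_iff_ae_notMem.1 h0] with ω hω hmem
      by_contra! hlt
      exact hmem fun j => hω.eventually_lt_const (hlt.trans (by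
        have : (0 : ℝ) < 1 / ((j : ℝ) + 1) := by positivity
        linarith))
    · right
      filter_upwards [hL, (prob_compl_eq_zero_iff hEm).2 h1 |> measure_eq_zero_iff_ae_notMem.1]
        with ω hω hmem
      rw [Set.notMem_compl_iff] at hmem
      refine le_of_tendsto_of_tendsto (tendsto_const_nhds (f := (atTop : Filter ℕ)))
        ((tendsto_const_nhds (x := q)).add tendsto_one_div_add_atTop_nhds_zero_nat)
        (Eventually.of_forall fun j => ?_) |>.trans_eq (add_zero q)
      exact le_of_tendsto hω ((hmem j).mono fun _ => le_of_lt)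
  have hlo : ∀ᵐ ω ∂μ, ∀ q : ℚ, (q : ℝ) < ∫ x, f x ∂μ → (q : ℝ) ≤ L ω := by
    refine ae_all_iff.2 fun q => ?_
    by_cases hq : (q : ℝ) < ∫ x, f x ∂μ
    · rcases hzo q with h | h
      · exact h.mono fun _ h _ => h
      · have := integral_mono_ae hLi (integrable_const _) h
        rw [hLint] at this
        simp at this
        linarith
    · exact ae_of_all _ fun _ h => absurd h hq
  have hhi : ∀ᵐ ω ∂μ, ∀ q : ℚ, ∫ x, f x ∂μ < (q : ℝ) → L ω ≤ (q : ℝ) := by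
    refine ae_all_iff.2 fun q => ?_
    by_cases hq : ∫ x, f x ∂μ < (q : ℝ)
    · rcases hzo q with h | h
      · have := integral_mono_ae (integrable_const _) hLi h
        rw [hLint] at this
        simp at this
        linarith
      · exact h.mono fun _ h _ => h
    · exact ae_of_all _ fun _ h => absurd h hq
  filter_upwards [hlo, hhi] with ω h1 h2
  refine le_antisymm ?_ ?_
  · by_contra! hlt
    obtain ⟨q, ha, hb⟩ := exists_rat_btwn hlt
    linarith [h2 q ha]
  · by_contra! hlt
    obtain ⟨q, ha, hb⟩ := exists_rat_btwn hlt
    linarith [h1 q hb]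

end Folner

/-- By concavity of entropy, some member of a finite family of nonnegative vectors has entropy at
most that of the mean of the family. -/
lemma exists_entropy_le_of_mean {ι κ : Type*} [Fintype κ] (T : Finset ι) (hT : T.Nonempty)
    (p : ι → κ → ℝ) (hp : ∀ i ∈ T, ∀ m, 0 ≤ p i m) (q : κ → ℝ)
    (hq : ∀ m, (T.card : ℝ)⁻¹ * ∑ i ∈ T, p i m = q m) :
    ∃ i ∈ T, -(∑ m, p i m * Real.logb 2 (p i m)) ≤ -(∑ m, q m * Real.logb 2 (q m)) := by
  have hT0 : (T.card : ℝ) ≠ 0 := by exact_mod_cast hT.card_pos.ne'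
  have hrw : ∀ r : κ → ℝ, -(∑ m, r m * Real.logb 2 (r m)) =
      (∑ m, Real.negMulLog (r m)) / Real.log 2 := fun r => by
    rw [Finset.sum_div, ← Finset.sum_neg_distrib]
    refine Finset.sum_congr rfl fun m _ => ?_
    rw [Real.negMulLog, Real.logb]
    ring
  simp only [hrw]
  suffices h : ∃ i ∈ T, ∑ m, Real.negMulLog (p i m) ≤ ∑ m, Real.negMulLog (q m) by
    obtain ⟨i, hi, h⟩ := h
    exact ⟨i, hi, div_le_div_of_nonneg_right h (Real.log_nonneg one_le_two)⟩
  have hJ : ∀ m, (T.card : ℝ)⁻¹ * ∑ i ∈ T, Real.negMulLog (p i m) ≤ Real.negMulLog (q m) := by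
    intro m
    have := Real.concaveOn_negMulLog.le_map_sum (t := T) (w := fun _ => (T.card : ℝ)⁻¹)
      (p := fun i => p i m) (fun _ _ => by positivity) (by simp [hT0])
      (fun i hi => hp i hi m)
    simpa only [smul_eq_mul, ← Finset.mul_sum, hq] using this
  refine Finset.exists_le_of_sum_le hT ?_
  rw [Finset.sum_comm, Finset.sum_const, nsmul_eq_mul, Finset.mul_sum]
  refine Finset.sum_le_sum fun m _ => ?_
  rw [← inv_mul_le_iff₀ (by exact_mod_cast hT.card_pos)]
  exact hJ m

theorem stmt11 {Γ : Type*} [Group Γ] [Countable Γ] [Infinite Γ] [DecidableEq Γ]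
    (F : ℕ → Finset Γ) (Z : ℕ → Set Γ)
    (hFl : IsLeftFolner F) (hFr : IsRightFolner F) (htemp : IsTempered F)
    (htile : ∀ n, IsLeftMonotiling (↑(F n)) (Z n))
    (hsymm : ∀ n, (Z n)⁻¹ = Z n)
    (he : ∀ n, (1 : Γ) ∈ F n)
    {X : Type*} [MeasurableSpace X] [MulAction Γ X] (μ : Measure X)
    [IsProbabilityMeasure μ]
    (hmeas : ∀ g : Γ, Measurable fun x : X => g • x)
    (hmp : ∀ g : Γ, MeasurePreserving (fun x : X => g • x) μ μ)
    (herg : ∀ E : Set X, MeasurableSet E → (∀ g : Γ, (fun x : X => g • x) ⁻¹' E = E) →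
      μ E = 0 ∨ μ E = 1)
    (hgood : ∀ k, IsGoodWeight (Set.indicator (Z k) 1) F μ)
    (M : ℕ → ℕ) (B : (k : ℕ) → Fin (M k) → Set X)
    (hBmeas : ∀ k m, MeasurableSet (B k m))
    (hBdisj : ∀ k, Pairwise fun m m' => Disjoint (B k m) (B k m'))
    (hBcover : ∀ k, (⋃ m, B k m) = Set.univ)
    (π : (k : ℕ) → Γ → Fin (M k) → X → ℝ)
    (hπ : ∀ (k : ℕ) (h : Γ) (m : Fin (M k)), ∀ᵐ ω ∂μ,
      Tendsto
        (fun n => (Nat.card ↥((↑(F n) : Set Γ) ∩ Z k) : ℝ)⁻¹ *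
          ∑ g ∈ F n, Set.indicator (Z k) 1 g * Set.indicator (B k m) 1 ((g * h) • ω))
        atTop (𝓝 (π k h m ω))) :
    ∀ᵐ ω ∂μ, ∀ k : ℕ, ∃ h ∈ ((↑(F k) : Set Γ))⁻¹,
      -(∑ m : Fin (M k), π k h m ω * Real.logb 2 (π k h m ω)) ≤
        -(∑ m : Fin (M k), (μ (B k m)).toReal * Real.logb 2 (μ (B k m)).toReal) := by
  have hind : ∀ k m x, |Set.indicator (B k m) (1 : X → ℝ) x| ≤ 1 := fun k m x => by
    by_cases h : x ∈ B k m <;> simp [h]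
  have hpt : ∀ᵐ ω ∂μ, ∀ k h m, Tendsto
      (fun n => (Nat.card ↥((↑(F n) : Set Γ) ∩ Z k) : ℝ)⁻¹ *
        ∑ g ∈ F n, Set.indicator (Z k) 1 g * Set.indicator (B k m) 1 ((g * h) • ω))
      atTop (𝓝 (π k h m ω)) :=
    ae_all_iff.2 fun k => ae_all_iff.2 fun h => ae_all_iff.2 fun m => hπ k h m
  have hmean : ∀ᵐ ω ∂μ, ∀ k m,
      ((F k).card : ℝ)⁻¹ * ∑ f ∈ F k, π k f⁻¹ m ω = (μ (B k m)).toReal := by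
    refine ae_all_iff.2 fun k => ae_all_iff.2 fun m => ?_
    have h := hFr.ae_eq_integral_of_tendsto μ hmp herg (Set.indicator (B k m) 1)
      (measurable_one.indicator (hBmeas k m)) (hind k m)
      (fun ω => ((F k).card : ℝ)⁻¹ * ∑ f ∈ F k, π k f⁻¹ m ω) (by
        filter_upwards [hpt] with ω hω
        exact hFr.tendsto_average_of_tendsto_centers (htile k) (hsymm k) (hFr.1 k)
          (fun g => Set.indicator (B k m) 1 (g • ω)) (fun g => hind k m _)
          (fun f => π k f⁻¹ m ω) (fun f _ => hω k f⁻¹ m))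
    rw [integral_indicator_one (hBmeas k m)] at h
    exact h
  filter_upwards [hpt, hmean] with ω hω hmω k
  obtain ⟨f, hf, hle⟩ := exists_entropy_le_of_mean (F k) (hFr.1 k) (fun f m => π k f⁻¹ m ω)
    (fun f _ m => ge_of_tendsto' (hω k f⁻¹ m) fun n => mul_nonneg (by positivity)
      (Finset.sum_nonneg fun g _ => mul_nonneg
        (Set.indicator_nonneg (fun _ _ => zero_le_one) _)
        (Set.indicator_nonneg (fun _ _ => zero_le_one) _)))
    (fun m => (μ (B k m)).toReal) (hmω k)
  exact ⟨f⁻¹, by simpa using hf, hle⟩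
end

section
/- In the discrete Heisenberg group H₃ = UT(3, ℤ), for each n ≥ 1 let F_n := {(a,b,c) ∈ H₃ : 0 ≤ a < n, 0 ≤ b < n, 0 ≤ c < n²}. Then for every n > 1 one has F_n⁻¹ F_n ⊆ {(a,b,c) : −n < a < n, −n < b < n, −3n² < c < 3n²} and ⋃_{i<n} F_i⁻¹ F_n ⊆ F_n⁻¹ F_n; consequently |⋃_{i<n} F_i⁻¹ F_n| ≤ 24·|F_n| for every n (note |F_n| = n⁴), so the sequence (F_n)_{n≥1} is tempered. -/
open scoped Pointwise

/-- The discrete Heisenberg group `H₃ = UT(3, ℤ)`, identified with triples `(a, b, c)`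
of integers (the `(1,2)`, `(2,3)` and `(1,3)` entries respectively). -/
@[ext]
structure H3 where
  a : ℤ
  b : ℤ
  c : ℤ

namespace H3

instance : Mul H3 := ⟨fun p q => ⟨p.a + q.a, p.b + q.b, p.c + q.c + p.a * q.b⟩⟩
instance : One H3 := ⟨⟨0, 0, 0⟩⟩
instance : Inv H3 := ⟨fun p => ⟨-p.a, -p.b, p.a * p.b - p.c⟩⟩

@[simp] lemma mul_a (p q : H3) : (p * q).a = p.a + q.a := rfl
@[simp] lemma mul_b (p q : H3) : (p * q).b = p.b + q.b := rfl
@[simp] lemma mul_c (p q : H3) : (p * q).c = p.c + q.c + p.a * q.b := rfl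
@[simp] lemma one_a : (1 : H3).a = 0 := rfl
@[simp] lemma one_b : (1 : H3).b = 0 := rfl
@[simp] lemma one_c : (1 : H3).c = 0 := rfl
@[simp] lemma inv_a (p : H3) : p⁻¹.a = -p.a := rfl
@[simp] lemma inv_b (p : H3) : p⁻¹.b = -p.b := rfl
@[simp] lemma inv_c (p : H3) : p⁻¹.c = p.a * p.b - p.c := rfl

instance : Group H3 where
  mul_assoc p q r := by ext <;> simp <;> ring
  one_mul p := by ext <;> simp
  mul_one p := by ext <;> simp
  inv_mul_cancel p := by ext <;> simp

end H3

/-- The tile `F_n = {(a,b,c) : 0 ≤ a < n, 0 ≤ b < n, 0 ≤ c < n²}` in `H₃`. -/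
def heisTile (n : ℕ) : Set H3 :=
  {g | 0 ≤ g.a ∧ g.a < (n : ℤ) ∧ 0 ≤ g.b ∧ g.b < (n : ℤ) ∧ 0 ≤ g.c ∧ g.c < (n : ℤ) ^ 2}

/-- A half-open box in `H₃` corresponds to a product of integer intervals. -/
def H3.boxEquiv (l₁ u₁ l₂ u₂ l₃ u₃ : ℤ) :
    {g : H3 | l₁ ≤ g.a ∧ g.a < u₁ ∧ l₂ ≤ g.b ∧ g.b < u₂ ∧ l₃ ≤ g.c ∧ g.c < u₃} ≃
      Finset.Ico l₁ u₁ × Finset.Ico l₂ u₂ × Finset.Ico l₃ u₃ where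
  toFun g := (⟨g.1.a, Finset.mem_Ico.2 ⟨g.2.1, g.2.2.1⟩⟩,
    ⟨g.1.b, Finset.mem_Ico.2 ⟨g.2.2.2.1, g.2.2.2.2.1⟩⟩,
    ⟨g.1.c, Finset.mem_Ico.2 g.2.2.2.2.2⟩)
  invFun x := ⟨⟨x.1, x.2.1, x.2.2⟩, (Finset.mem_Ico.1 x.1.2).1, (Finset.mem_Ico.1 x.1.2).2,
    (Finset.mem_Ico.1 x.2.1.2).1, (Finset.mem_Ico.1 x.2.1.2).2, Finset.mem_Ico.1 x.2.2.2⟩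
  left_inv _ := rfl
  right_inv _ := rfl

lemma H3.card_box (l₁ u₁ l₂ u₂ l₃ u₃ : ℤ) :
    Nat.card {g : H3 | l₁ ≤ g.a ∧ g.a < u₁ ∧ l₂ ≤ g.b ∧ g.b < u₂ ∧ l₃ ≤ g.c ∧ g.c < u₃} =
      (u₁ - l₁).toNat * ((u₂ - l₂).toNat * (u₃ - l₃).toNat) := by
  rw [Nat.card_congr (H3.boxEquiv l₁ u₁ l₂ u₂ l₃ u₃), Nat.card_prod, Nat.card_prod]
  simp only [Nat.card_eq_fintype_card, Fintype.card_coe, Int.card_Ico]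

lemma H3.finite_box (l₁ u₁ l₂ u₂ l₃ u₃ : ℤ) :
    {g : H3 | l₁ ≤ g.a ∧ g.a < u₁ ∧ l₂ ≤ g.b ∧ g.b < u₂ ∧ l₃ ≤ g.c ∧ g.c < u₃}.Finite :=
  Set.finite_coe_iff.1 (Finite.of_equiv _ (H3.boxEquiv l₁ u₁ l₂ u₂ l₃ u₃).symm)

lemma heisTile_mono {i n : ℕ} (h : i ≤ n) : heisTile i ⊆ heisTile n := by
  rintro g ⟨h1, h2, h3, h4, h5, h6⟩
  have hi : (i : ℤ) ≤ n := by exact_mod_cast h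
  have hsq : (i : ℤ) ^ 2 ≤ (n : ℤ) ^ 2 := by gcongr
  exact ⟨h1, by omega, h3, by omega, h5, by omega⟩

lemma iUnion_heisTile_inv_mul_subset (n : ℕ) :
    (⋃ i < n, (heisTile i)⁻¹ * heisTile n) ⊆ (heisTile n)⁻¹ * heisTile n :=
  Set.iUnion₂_subset fun _ hi =>
    Set.mul_subset_mul_right (Set.inv_subset_inv.2 (heisTile_mono hi.le))

lemma heisTile_inv_mul_subset (n : ℕ) :
    (heisTile n)⁻¹ * heisTile n ⊆
      {g : H3 | -(n : ℤ) < g.a ∧ g.a < (n : ℤ) ∧ -(n : ℤ) < g.b ∧ g.b < (n : ℤ) ∧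
        -(3 * (n : ℤ) ^ 2) < g.c ∧ g.c < 3 * (n : ℤ) ^ 2} := by
  rintro _ ⟨p, hp, q, ⟨h1, h2, h3, h4, h5, h6⟩, rfl⟩
  obtain ⟨k1, k2, k3, k4, k5, k6⟩ := hp
  simp only [H3.inv_a, H3.inv_b, H3.inv_c] at k1 k2 k3 k4 k5 k6
  simp only [Set.mem_ofPred_eq, H3.mul_a, H3.mul_b, H3.mul_c]
  have e1 : 0 ≤ p.a * p.b := by nlinarith
  have e2 : p.a * p.b ≤ (n : ℤ) ^ 2 := by nlinarith
  have e3 : p.a * q.b ≤ 0 := by nlinarith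
  have e4 : -(n : ℤ) ^ 2 ≤ p.a * q.b := by nlinarith
  refine ⟨by omega, by omega, by omega, by omega, by linarith, by linarith⟩

lemma card_heisTile (n : ℕ) : Nat.card ↥(heisTile n) = n ^ 4 := by
  have h := H3.card_box 0 n 0 n 0 ((n : ℤ) ^ 2)
  have hsq : ((n : ℤ) ^ 2).toNat = n ^ 2 := by exact_mod_cast Int.toNat_natCast (n ^ 2)
  simp only [sub_zero, Int.toNat_natCast, hsq] at h
  rw [heisTile, h]
  ring

lemma card_iUnion_heisTile_inv_mul_le (n : ℕ) :
    Nat.card ↥(⋃ i < n, (heisTile i)⁻¹ * heisTile n) ≤ 24 * n ^ 4 := by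
  have hsub : (⋃ i < n, (heisTile i)⁻¹ * heisTile n) ⊆
      {g : H3 | -(n : ℤ) ≤ g.a ∧ g.a < (n : ℤ) ∧ -(n : ℤ) ≤ g.b ∧ g.b < (n : ℤ) ∧
        -(3 * (n : ℤ) ^ 2) ≤ g.c ∧ g.c < 3 * (n : ℤ) ^ 2} := fun g hg => by
    obtain ⟨h1, h2, h3, h4, h5, h6⟩ :=
      heisTile_inv_mul_subset n (iUnion_heisTile_inv_mul_subset n hg)
    exact ⟨h1.le, h2, h3.le, h4, h5.le, h6⟩
  refine (Nat.card_mono (H3.finite_box _ _ _ _ _ _) hsub).trans ?_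
  have e1 : ((n : ℤ) - -n).toNat = 2 * n := by omega
  have e2 : (3 * (n : ℤ) ^ 2 - -(3 * (n : ℤ) ^ 2)).toNat = 6 * n ^ 2 := by
    zify
    rw [Int.toNat_of_nonneg (by nlinarith [sq_nonneg (n : ℤ)])]
    ring
  rw [H3.card_box, e1, e2]
  exact le_of_eq (by ring)

theorem stmt18 :
    -- for every `n > 1`, `F_n⁻¹ F_n` is contained in a box:
    (∀ n : ℕ, 1 < n →
      (heisTile n)⁻¹ * heisTile n ⊆
        {g : H3 | -(n : ℤ) < g.a ∧ g.a < (n : ℤ) ∧ -(n : ℤ) < g.b ∧ g.b < (n : ℤ) ∧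
          -(3 * (n : ℤ) ^ 2) < g.c ∧ g.c < 3 * (n : ℤ) ^ 2}) ∧
    -- for every `n > 1`, `⋃_{i<n} F_i⁻¹ F_n ⊆ F_n⁻¹ F_n`:
    (∀ n : ℕ, 1 < n →
      (⋃ i < n, (heisTile i)⁻¹ * heisTile n) ⊆ (heisTile n)⁻¹ * heisTile n) ∧
    -- consequently `|⋃_{i<n} F_i⁻¹ F_n| ≤ 24 |F_n|` for every `n` (note `|F_n| = n⁴`):
    (∀ n : ℕ, Nat.card ↥(heisTile n) = n ^ 4) ∧
    (∀ n : ℕ,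
      (Nat.card ↥(⋃ i < n, (heisTile i)⁻¹ * heisTile n) : ℝ) ≤
        24 * Nat.card ↥(heisTile n)) ∧
    -- so the sequence `(F_n)` is tempered:
    ∃ C : ℝ, ∀ j : ℕ,
      (Nat.card ↥(⋃ i < j, (heisTile i)⁻¹ * heisTile j) : ℝ) ≤
        C * Nat.card ↥(heisTile j) := by
  have hcard : ∀ n : ℕ, (Nat.card ↥(⋃ i < n, (heisTile i)⁻¹ * heisTile n) : ℝ) ≤
      24 * Nat.card ↥(heisTile n) := fun n => by
    rw [card_heisTile]
    exact_mod_cast card_iUnion_heisTile_inv_mul_le n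
  exact ⟨fun n _ => heisTile_inv_mul_subset n, fun n _ => iUnion_heisTile_inv_mul_subset n,
    card_heisTile, hcard, 24, hcard⟩
end
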